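/- Let f be a slice regular self-map of 𝔹 and p ∈ 𝔹. Then |f⋆_p(q)| ≤ 1 for all q ∈ 𝔹. If f is not of the form ℳ_{p'} u with p' ∈ 𝔹 and |u| = 1 (a regular Möbius transformation times a unimodular constant), the inequality is strict for every q ∈ 𝔹; if f is of this form, then f⋆_p is identically equal to a unimodular constant. -/

import Mathlib

noncomputable section

abbrev H : Type := Quaternion ℝ

namespace QPaper

/-- The complex slice determined by `I`: the real span of `1` and `I`. -/
def sliceSet (I : H) : Set H := {q | ∃ x y : ℝ, q = (x : H) + y • I}

/-- Evaluation of the power series `q ↦ ∑ qᵐ aₘ` with right coefficients. -/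
def evalC (a : ℕ → H) (q : H) : H := ∑' m, q ^ m * a m

/-- The series with coefficients `a` converges at every point of the unit ball. -/
def SummableOn (a : ℕ → H) : Prop := ∀ q : H, ‖q‖ < 1 → Summable fun m => q ^ m * a m

/-- `a` are the coefficients of a slice regular self-map of the unit ball. -/
def SelfMap (a : ℕ → H) : Prop :=
  SummableOn a ∧ ∀ q : H, ‖q‖ < 1 → ‖evalC a q‖ < 1

/-- Coefficients of the ∗-product. -/
def starMulC (a b : ℕ → H) : ℕ → H := fun m => ∑ ℓ ∈ Finset.range (m + 1), a (m - ℓ) * b ℓ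

/-- Coefficients of the ∗-inverse (of a series with invertible constant term). -/
def starInvC (a : ℕ → H) : ℕ → H
  | 0 => (a 0)⁻¹
  | m + 1 => -(a 0)⁻¹ * ∑ ℓ : Fin (m + 1), a (m + 1 - ℓ.val) * starInvC a ℓ.val
  decreasing_by exact ℓ.isLt

/-- Coefficients of `1 - q p̄`. -/
def oneMinusQPbarC (p : H) : ℕ → H := fun m => if m = 0 then 1 else if m = 1 then -(star p) else 0

/-- Coefficients of `q - p`. -/
def qMinusPC (p : H) : ℕ → H := fun m => if m = 0 then -p else if m = 1 then 1 else 0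

/-- Coefficients of the regular Möbius transformation `ℳ_p = (1 - q p̄)^{-∗} ∗ (q - p)`. -/
def mobiusC (p : H) : ℕ → H := starMulC (starInvC (oneMinusQPbarC p)) (qMinusPC p)

/-- Coefficients of `ℳ_{t₁} ∗ ⋯ ∗ ℳ_{t_κ}`. -/
def blaschkeListC : List H → (ℕ → H)
  | [] => fun m => if m = 0 then 1 else 0
  | t :: ts => starMulC (mobiusC t) (blaschkeListC ts)

/-- `a` are the coefficients of a regular Blaschke product of degree `κ`,
i.e. of `ℳ_{t₁} ∗ ⋯ ∗ ℳ_{t_κ} u` with the `tᵢ` in `𝔹` and `u` unimodular. -/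
def IsBlaschke (a : ℕ → H) (κ : ℕ) : Prop :=
  ∃ (ts : List H) (u : H), ts.length = κ ∧ (∀ t ∈ ts, ‖t‖ < 1) ∧ ‖u‖ = 1 ∧
    a = fun m => blaschkeListC ts m * u

/-- Coefficients of `ℳ_w ∙ f = (1 - f w̄)^{-∗} ∗ (f - w)`. -/
def bulletC (w : H) (a : ℕ → H) : ℕ → H :=
  starMulC (starInvC (fun m => (if m = 0 then (1 : H) else 0) - a m * star w))
    (fun m => a m - if m = 0 then w else 0)

/-- Coefficients of the regular difference quotient `ℛ_{f,p}`,
the unique slice regular function with `f(q) = f(p) + (q - p) ∗ ℛ_{f,p}(q)`. -/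
def diffQuotC (a : ℕ → H) (p : H) : ℕ → H := fun m => ∑' k, p ^ k * a (k + m + 1)

/-- Coefficients of the hyperbolic difference quotient
`f⋆_p = (1 - q p̄) ∗ ℛ_{f,p} ∗ (1 - \overline{f(p)} f)^{-∗} = ℳ_p^{-∗} ∗ (ℳ_{f(p)} ∙ f)`. -/
def hdqC (a : ℕ → H) (p : H) : ℕ → H :=
  starMulC (starMulC (oneMinusQPbarC p) (diffQuotC a p))
    (starInvC (fun m => (if m = 0 then (1 : H) else 0) - star (evalC a p) * a m))

/-- Iterated hyperbolic difference quotients: `ihdqC a [p₁, …, pₙ] = ((f⋆_{p₁})⋆_{p₂} ⋯)⋆_{pₙ}`. -/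
def ihdqC (a : ℕ → H) : List H → (ℕ → H)
  | [] => a
  | p :: ps => ihdqC (hdqC a p) ps

/-- `𝒯_p(q) = (1 - q p)⁻¹ q (1 - q p)`. -/
def mobiusT (p q : H) : H := (1 - q * p)⁻¹ * q * (1 - q * p)

/-- `M_p(q) = (1 - q p̄)⁻¹ (q - p)`. -/
def mobiusM (p q : H) : H := (1 - q * star p)⁻¹ * (q - p)

/-- Pointwise evaluation of the regular Möbius transformation: `ℳ_p(q) = M_p(𝒯_p(q))`. -/
def mobiusEval (p q : H) : H := mobiusM p (mobiusT p q)

/-- The pseudo-hyperbolic distance `ρ(p,q) = |M_p(q)|`. -/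
def rho (p q : H) : ℝ := ‖mobiusM p q‖

/-- The Poincaré distance `δ(p,q) = tanh⁻¹ ρ(p,q) = ½ log((1+ρ)/(1−ρ))`. -/
def pdist (p q : H) : ℝ := (1/2 : ℝ) * Real.log ((1 + rho p q) / (1 - rho p q))



open PowerSeries

/-- Power series evaluation with an inserted vector. -/
def ev (f : PowerSeries H) (q v : H) : H := ∑' m, q ^ m * v * coeff m f

def AS (f : PowerSeries H) : Prop :=
  ∀ r : ℝ, 0 ≤ r → r < 1 → Summable fun m => r ^ m * ‖coeff m f‖

theorem mk_starMulC (a b : ℕ → H) :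
    PowerSeries.mk (starMulC a b) = PowerSeries.mk a * PowerSeries.mk b := by
  ext1 n
  rw [coeff_mul, coeff_mk, Finset.Nat.sum_antidiagonal_eq_sum_range_succ_mk, starMulC,
    ← Finset.sum_range_reflect]
  apply Finset.sum_congr rfl
  intro k hk
  have : k ≤ n := by simpa [Nat.lt_succ_iff] using hk
  have h3 : n - (n - k) = k := by omega
  simp [h3]

theorem mk_mul_starInvC (a : ℕ → H) (h0 : a 0 ≠ 0) :
    PowerSeries.mk a * PowerSeries.mk (starInvC a) = 1 := by
  rw [← mk_starMulC]
  ext1 n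
  rw [coeff_mk, coeff_one]
  cases n with
  | zero => simp [starMulC, starInvC, h0]
  | succ n =>
    rw [starMulC, Finset.sum_range_succ]
    rw [starInvC, ← Fin.sum_univ_eq_sum_range (fun ℓ => a (n + 1 - ℓ) * starInvC a ℓ) (n + 1)]
    simp [h0]

theorem starInvC_zero_ne (a : ℕ → H) (h0 : a 0 ≠ 0) : starInvC a 0 ≠ 0 := by
  rw [starInvC]; exact inv_ne_zero h0

theorem starInvC_mul_mk (a : ℕ → H) (h0 : a 0 ≠ 0) :
    PowerSeries.mk (starInvC a) * PowerSeries.mk a = 1 := by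
  have h1 := mk_mul_starInvC a h0
  have h2 := mk_mul_starInvC (starInvC a) (starInvC_zero_ne a h0)
  have : PowerSeries.mk a = PowerSeries.mk (starInvC (starInvC a)) := by
    calc PowerSeries.mk a = PowerSeries.mk a *
        (PowerSeries.mk (starInvC a) * PowerSeries.mk (starInvC (starInvC a))) := by
          rw [h2, mul_one]
      _ = _ := by rw [← mul_assoc, h1, one_mul]
  rw [this]; exact h2

theorem AS.summable_norm {f : PowerSeries H} (hf : AS f) {q : H} (hq : ‖q‖ < 1) (v : H) :
    Summable fun m => ‖q ^ m * v * coeff m f‖ := by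
  refine ((hf ‖q‖ (norm_nonneg _) hq).mul_left ‖v‖).congr fun m => ?_
  rw [norm_mul, norm_mul, norm_pow]; ring

theorem AS.summable {f : PowerSeries H} (hf : AS f) {q : H} (hq : ‖q‖ < 1) (v : H) :
    Summable fun m => q ^ m * v * coeff m f := (hf.summable_norm hq v).of_norm

theorem AS_of_bdd {f : PowerSeries H} {C : ℝ} (h : ∀ m, ‖coeff m f‖ ≤ C) : AS f := by
  intro r h0 h1
  refine Summable.of_nonneg_of_le (fun m => by positivity) (fun m => ?_)
    ((summable_geometric_of_lt_one h0 h1).mul_right C)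
  exact mul_le_mul_of_nonneg_left (h m) (by positivity)

theorem AS_of_summableOn {a : ℕ → H} (h : SummableOn a) : AS (PowerSeries.mk a) := by
  intro r h0 h1
  obtain ⟨s, hs1, hs2⟩ := exists_between h1
  have hs0 : 0 < s := h0.trans_lt hs1
  have hsn : ‖(s : H)‖ = s := by rw [Quaternion.norm_coe, Real.norm_of_nonneg hs0.le]
  have := h (s : H) (by rwa [hsn])
  have ht := this.tendsto_atTop_zero.norm
  obtain ⟨C, hC⟩ := ht.bddAbove_range
  have hC' : ∀ m, s ^ m * ‖a m‖ ≤ C := fun m => by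
    have := hC ⟨m, rfl⟩
    simpa [norm_mul, norm_pow, hsn, abs_of_pos hs0] using this
  refine Summable.of_nonneg_of_le (fun m => by positivity) (fun m => ?_)
    ((summable_geometric_of_lt_one (r := r / s) (by positivity)
      ((div_lt_one hs0).2 hs1)).mul_right C)
  rw [coeff_mk]
  calc r ^ m * ‖a m‖ = (r / s) ^ m * (s ^ m * ‖a m‖) := by
        rw [div_pow]; field_simp
    _ ≤ _ := mul_le_mul_of_nonneg_left (hC' m) (by positivity)

theorem AS.sub {f g : PowerSeries H} (hf : AS f) (hg : AS g) : AS (f - g) := by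
  intro r h0 h1
  refine Summable.of_nonneg_of_le (fun m => by positivity) (fun m => ?_)
    ((hf r h0 h1).add (hg r h0 h1))
  rw [map_sub, ← mul_add]
  exact mul_le_mul_of_nonneg_left (norm_sub_le _ _) (by positivity)

theorem AS_C (b : H) : AS (C b) := by
  apply AS_of_bdd (C := ‖b‖)
  intro m; rw [coeff_C]; split_ifs <;> simp

theorem AS_X : AS (X : PowerSeries H) := by
  apply AS_of_bdd (C := 1)
  intro m; rw [coeff_X]; split_ifs <;> simp

theorem AS_one : AS (1 : PowerSeries H) := by
  simpa using AS_C 1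

theorem AS.mul {f g : PowerSeries H} (hf : AS f) (hg : AS g) : AS (f * g) := by
  intro r h0 h1
  have hs := summable_norm_sum_mul_antidiagonal_of_summable_norm
    (f := fun m => r ^ m * ‖coeff m f‖) (g := fun m => r ^ m * ‖coeff m g‖)
    (hf r h0 h1).norm (hg r h0 h1).norm
  refine Summable.of_nonneg_of_le (fun m => by positivity) (fun m => ?_) hs
  rw [coeff_mul, Real.norm_of_nonneg (Finset.sum_nonneg fun _ _ => by positivity)]
  calc r ^ m * ‖∑ x ∈ Finset.HasAntidiagonal.antidiagonal m, coeff x.1 f * coeff x.2 g‖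
      ≤ r ^ m * ∑ x ∈ Finset.HasAntidiagonal.antidiagonal m, ‖coeff x.1 f‖ * ‖coeff x.2 g‖ := by
        apply mul_le_mul_of_nonneg_left _ (by positivity)
        refine (norm_sum_le _ _).trans (Finset.sum_le_sum fun x _ => ?_)
        rw [norm_mul]
    _ = _ := by
        rw [Finset.mul_sum]
        refine Finset.sum_congr rfl fun x hx => ?_
        rw [← Finset.HasAntidiagonal.mem_antidiagonal.1 hx, pow_add]; ring

theorem ev_sub {f g : PowerSeries H} (hf : AS f) (hg : AS g) {q : H} (hq : ‖q‖ < 1) (v : H) :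
    ev (f - g) q v = ev f q v - ev g q v := by
  rw [ev, ev, ev, ← (hf.summable hq v).tsum_sub (hg.summable hq v)]
  simp [mul_sub]

theorem ev_C (b q v : H) : ev (C b) q v = v * b := by
  rw [ev, tsum_eq_single 0]
  · simp
  · intro m hm; simp [coeff_C, hm]

theorem ev_one (q v : H) : ev 1 q v = v := by
  have := ev_C 1 q v
  simpa using this

theorem ev_X (q v : H) : ev X q v = q * v := by
  rw [ev, tsum_eq_single 1]
  · simp
  · intro m hm; simp [coeff_X, hm]

theorem ev_mul {f g : PowerSeries H} (hf : AS f) (hg : AS g) {q : H} (hq : ‖q‖ < 1) (v : H) :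
    ev (f * g) q v = ev g q (ev f q v) := by
  set F : ℕ × ℕ → H := fun x => q ^ (x.1 + x.2) * v * coeff x.1 f * coeff x.2 g with hF
  have hsum : Summable F := by
    apply Summable.of_norm
    have := (hf ‖q‖ (norm_nonneg _) hq).mul_of_nonneg (hg ‖q‖ (norm_nonneg _) hq)
      (fun m => by positivity) (fun m => by positivity)
    refine (this.mul_left ‖v‖).congr fun x => ?_
    simp only [hF, norm_mul, norm_pow, pow_add]; ring
  have h1 : ev (f * g) q v = ∑' x, F x := by
    rw [← Finset.HasAntidiagonal.sigmaAntidiagonalEquivProd.tsum_eq F,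
      Summable.tsum_sigma' (f := fun c => F (Finset.HasAntidiagonal.sigmaAntidiagonalEquivProd c))
        (fun n => (hasSum_fintype _).summable)
        (Finset.HasAntidiagonal.sigmaAntidiagonalEquivProd.summable_iff.2 hsum), ev]
    congr 1; ext1 n
    rw [tsum_fintype, coeff_mul, Finset.mul_sum, ← Finset.sum_coe_sort]
    refine Finset.sum_congr rfl fun x _ => ?_
    simp only [hF, Finset.HasAntidiagonal.sigmaAntidiagonalEquivProd_apply]
    rw [Finset.HasAntidiagonal.mem_antidiagonal.1 x.2]
    simp only [mul_assoc]
  rw [h1, ← (Equiv.prodComm ℕ ℕ).tsum_eq F,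
    Summable.tsum_prod (f := fun c => F (Equiv.prodComm ℕ ℕ c))
      ((Equiv.prodComm ℕ ℕ).summable_iff.2 hsum), ev]
  congr 1; ext1 n
  rw [ev, ← (hf.summable hq v).tsum_mul_left, ← Summable.tsum_mul_right]
  · congr 1; ext1 m
    simp only [hF, Equiv.prodComm_apply, Prod.swap]
    rw [add_comm, pow_add]
    simp only [mul_assoc]
  · exact (hf.summable hq v).mul_left _

theorem evalC_eq_ev (a : ℕ → H) (q : H) : evalC a q = ev (PowerSeries.mk a) q 1 := by
  simp [evalC, ev]

theorem ev_conj (f : PowerSeries H) (q v : H) (hv : v ≠ 0) :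
    ev f q v = v * ev f (v⁻¹ * q * v) 1 := by
  rw [ev, ev, ← tsum_mul_left]
  congr 1; ext1 m
  have : (v⁻¹ * q * v) ^ m = v⁻¹ * q ^ m * v := by
    induction m with
    | zero => simp [hv]
    | succ n ih => rw [pow_succ, ih, pow_succ]; simp [mul_assoc, hv]
  rw [this]; simp [← mul_assoc, hv]

theorem ev_zero_right (f : PowerSeries H) (q : H) : ev f q 0 = 0 := by simp [ev]


/-- The quaternions as a complex normed space, by left multiplication. -/
def E : Type := H

instance instE1 : NormedAddCommGroup E := inferInstanceAs (NormedAddCommGroup H)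

instance instE2 : Module ℂ E :=
  Module.compHom (R := H) H (Quaternion.ofComplex : ℂ →ₐ[ℝ] H).toRingHom

theorem norm_coeComplex (z : ℂ) : ‖(z : H)‖ = ‖z‖ := by
  have h : ‖(z : H)‖ * ‖(z : H)‖ = ‖z‖ * ‖z‖ := by
    rw [← Quaternion.normSq_eq_norm_mul_self, Complex.norm_mul_self_eq_normSq,
      Quaternion.normSq_def', Complex.normSq_apply]
    simp; ring
  exact (mul_self_inj (norm_nonneg _) (norm_nonneg _)).1 h

def toE (x : H) : E := x

theorem smul_toE (z : ℂ) (x : H) : z • toE x = toE ((z : H) * x) := rfl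

theorem norm_toE (x : H) : ‖toE x‖ = ‖x‖ := rfl

theorem norm_smul_aux (z : ℂ) (x : H) : ‖(z : H) * x‖ ≤ ‖z‖ * ‖x‖ := by
  rw [norm_mul, norm_coeComplex]

theorem mem_eb (z : ℂ) : z ∈ Metric.eball (0 : ℂ) 1 ↔ ‖z‖ < 1 := by
  rw [mem_eball_zero_iff, ← ofReal_norm, ENNReal.ofReal_lt_one]

instance instE3 : NormedSpace ℂ E where
  norm_smul_le z x := by
    exact norm_smul_aux z x

instance instE4 : CompleteSpace E := inferInstanceAs (CompleteSpace H)

instance instE5 : StrictConvexSpace ℝ E := by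
  apply StrictConvexSpace.of_norm_add_ne_two
  intro x y hx hy hxy h
  have hx' : @norm H _ x = 1 := hx
  have hy' : @norm H _ y = 1 := hy
  have h' : ‖(show H from x) + (show H from y)‖ = 2 := h
  apply hxy
  have := eq_of_norm_eq_of_norm_add_eq (E := H) (x := x) (y := y) (hx'.trans hy'.symm)
    (by rw [hx', hy']; exact h'.trans (by norm_num))
  exact this

def ps (f : PowerSeries H) (v : H) : FormalMultilinearSeries ℂ ℂ E :=
  fun n => ContinuousMultilinearMap.mkPiRing ℂ (Fin n) (toE (v * coeff n f))

theorem coeComplex_pow (z : ℂ) (n : ℕ) : ((z ^ n : ℂ) : H) = (z : H) ^ n := by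
  induction n with
  | zero => simp
  | succ n ih => rw [pow_succ, pow_succ, Quaternion.coeComplex_mul, ih]

theorem hasFPS {f : PowerSeries H} (hf : AS f) (v : H) :
    HasFPowerSeriesOnBall (fun z : ℂ => toE (ev f z v)) (ps f v) 0 1 where
  r_le := by
    refine ENNReal.le_of_forall_nnreal_lt fun r hr => ?_
    apply FormalMultilinearSeries.le_radius_of_summable
    have hr1 : (r : ℝ) < 1 := by exact_mod_cast hr
    refine ((hf r r.2 hr1).mul_left ‖v‖).congr fun n => ?_
    rw [ps, ContinuousMultilinearMap.norm_mkPiRing, norm_toE, norm_mul]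
    ring
  r_pos := one_pos
  hasSum := by
    intro y hy
    have hy1 : ‖y‖ < 1 := (mem_eb y).1 hy
    have := (hf.summable (q := (y : H)) (by rwa [norm_coeComplex]) v).hasSum
    rw [zero_add]
    have he : (fun n => ps f v n fun _ => y) = fun n => toE ((y : H) ^ n * v * coeff n f) := by
      ext1 n
      simp only [ps, ContinuousMultilinearMap.mkPiRing_apply, Finset.prod_const, Finset.card_univ,
        Fintype.card_fin, smul_toE, coeComplex_pow, mul_assoc]
    rw [he]
    exact this

theorem ev_diffOn {f : PowerSeries H} (hf : AS f) (v : H) :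
    DifferentiableOn ℂ (fun z : ℂ => toE (ev f z v)) (Metric.ball 0 1) := by
  have := (hasFPS hf v).differentiableOn
  intro z hz
  apply (this z ?_).mono
  · intro w hw
    exact (mem_eb w).2 (by simpa using hw)
  · exact (mem_eb z).2 (by simpa using hz)

theorem ps_coeff_eq {f g : PowerSeries H} {v w : H} (h : ps f v = ps g w) (n : ℕ) :
    v * coeff n f = w * coeff n g := by
  have := congrFun h n
  have h2 := congrArg (fun m => m (fun _ => (1 : ℂ))) this
  simp only [ps, ContinuousMultilinearMap.mkPiRing_apply, Finset.prod_const, one_pow,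
    one_smul] at h2
  exact h2

theorem cauchy_bd {f : PowerSeries H} (hf : AS f) (v : H) (C : ℝ)
    (h : ∀ z : ℂ, ‖z‖ < 1 → ‖ev f z v‖ ≤ C) (m : ℕ) : ‖v * coeff m f‖ ≤ C := by
  have hd := ev_diffOn hf v
  have key : ∀ R : NNReal, 0 < R → R < 1 → ‖v * coeff m f‖ * (R : ℝ) ^ m ≤ C := by
    intro R hR hR1
    have hR1' : (R : ℝ) < 1 := by exact_mod_cast hR1
    have hR' : (0 : ℝ) < R := by exact_mod_cast hR
    have h1 := (hd.mono (Metric.closedBall_subset_ball hR1')).hasFPowerSeriesOnBall hR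
    have h2 := (hasFPS hf v).hasFPowerSeriesAt.eq_formalMultilinearSeries h1.hasFPowerSeriesAt
    have h3 := norm_cauchyPowerSeries_le (fun z : ℂ => toE (ev f z v)) 0 R m
    rw [← h2, ps, ContinuousMultilinearMap.norm_mkPiRing, norm_toE] at h3
    have h4 : ∫ θ : ℝ in 0..2 * Real.pi, ‖toE (ev f (circleMap 0 R θ) v)‖ ≤ 2 * Real.pi * C := by
      have h5 : ∀ θ : ℝ, ‖toE (ev f (circleMap 0 R θ) v)‖ ≤ C := fun θ => by
        rw [norm_toE]; apply h; simpa using hR1'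
      have h6 := intervalIntegral.norm_integral_le_of_norm_le_const (a := 0) (b := 2 * Real.pi)
        (C := C) (f := fun θ => ‖toE (ev f (circleMap 0 R θ) v)‖)
        (fun θ _ => by rw [norm_norm]; exact h5 θ)
      refine (Real.le_norm_self _).trans (h6.trans (le_of_eq ?_))
      rw [sub_zero, abs_of_pos Real.two_pi_pos]; ring
    have h7 : (2 * Real.pi)⁻¹ * ∫ θ : ℝ in 0..2 * Real.pi, ‖toE (ev f (circleMap 0 R θ) v)‖ ≤ C := by
      rw [inv_mul_le_iff₀ Real.two_pi_pos]; exact h4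
    calc ‖v * coeff m f‖ * (R : ℝ) ^ m ≤ (C * |(R : ℝ)|⁻¹ ^ m) * (R : ℝ) ^ m := by
          apply mul_le_mul_of_nonneg_right _ (by positivity)
          exact h3.trans (mul_le_mul_of_nonneg_right h7 (by positivity))
      _ = C := by
          rw [abs_of_pos hR', mul_assoc, ← mul_pow, inv_mul_cancel₀ hR'.ne']; simp
  have ht : Filter.Tendsto (fun R : ℝ => ‖v * coeff m f‖ * R ^ m) (nhdsWithin 1 (Set.Iio 1))
      (nhds (‖v * coeff m f‖ * 1 ^ m)) := by
    apply tendsto_nhdsWithin_of_tendsto_nhds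
    exact (Continuous.tendsto (by fun_prop) 1)
  rw [one_pow, mul_one] at ht
  refine le_of_tendsto ht ?_
  filter_upwards [Ioo_mem_nhdsLT (zero_lt_one (α := ℝ))] with R hR
  exact key ⟨R, hR.1.le⟩ hR.1 hR.2

/-- Maximum principle. -/
theorem max_bd {f : PowerSeries H} (hf : AS f) (v : H) (C : ℝ) {r : ℝ} (hr0 : 0 < r) (hr : r < 1)
    (h : ∀ z : ℂ, ‖z‖ = r → ‖ev f z v‖ ≤ C) (z : ℂ) (hz : ‖z‖ ≤ r) : ‖ev f z v‖ ≤ C := by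
  have hd : DiffContOnCl ℂ (fun z : ℂ => toE (ev f z v)) (Metric.ball 0 r) :=
    ((ev_diffOn hf v).mono
      (Metric.closure_ball_subset_closedBall.trans (Metric.closedBall_subset_ball hr))).diffContOnCl
  have := Complex.norm_le_of_forall_mem_frontier_norm_le Metric.isBounded_ball hd (C := C)
    (fun w hw => by
      rw [frontier_ball _ hr0.ne'] at hw
      exact h w (by simpa using hw)) (z := z)
    (by rw [closure_ball _ hr0.ne']; simpa using hz)
  exact this

/-- Strong maximum principle. -/
theorem max_strict {f : PowerSeries H} (hf : AS f) (v : H) (hv : v ≠ 0)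
    (h : ∀ z : ℂ, ‖z‖ < 1 → ‖ev f z v‖ ≤ ‖v‖) (z : ℂ) (hz : ‖z‖ < 1) (hzv : ‖ev f z v‖ = ‖v‖) :
    ∃ u : H, ‖u‖ = 1 ∧ f = C u := by
  have hc := Complex.eqOn_of_isPreconnected_of_isMaxOn_norm
    (convex_ball (0 : ℂ) 1).isPreconnected Metric.isOpen_ball (ev_diffOn hf v)
    (c := z) (by simpa using hz) (by
      intro w hw
      simp only [Function.comp, Set.mem_ofPred_eq, norm_toE]
      rw [hzv]; exact h w (by simpa using hw))
  refine ⟨v⁻¹ * ev f z v, ?_, ?_⟩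
  · rw [norm_mul, norm_inv, hzv, inv_mul_cancel₀ (norm_ne_zero_iff.2 hv)]
  have h1 := hasFPS hf v
  have h2 := hasFPS (AS_C (v⁻¹ * ev f z v)) v
  have h3 := h1.hasFPowerSeriesAt.eq_formalMultilinearSeries_of_eventually h2.hasFPowerSeriesAt
    (by
      filter_upwards [Metric.ball_mem_nhds (0 : ℂ) one_pos] with w hw
      have := hc hw
      simp only [Function.const] at this
      rw [this, ev_C]; simp [hv])
  ext1 n
  exact mul_left_cancel₀ hv (ps_coeff_eq h3 n)

theorem exists_conj (q : H) : ∃ (z : ℂ) (v : H), v ≠ 0 ∧ (z : H) * v = v * q := by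
  by_cases h : q.imJ = 0 ∧ q.imK = 0
  · refine ⟨⟨q.re, q.imI⟩, 1, one_ne_zero, ?_⟩
    ext <;> simp [h.1, h.2]
  · set s := Real.sqrt (q.imI ^ 2 + q.imJ ^ 2 + q.imK ^ 2) with hs
    have hs2 : s * s = q.imI ^ 2 + q.imJ ^ 2 + q.imK ^ 2 := Real.mul_self_sqrt (by positivity)
    refine ⟨⟨q.re, s⟩, q - (q.re : H) + ((⟨0, s⟩ : ℂ) : H), ?_, ?_⟩
    · intro h0
      apply h
      have h1 := congrArg (fun x : H => x.imJ) h0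
      have h2 := congrArg (fun x : H => x.imK) h0
      simp at h1 h2
      exact ⟨h1, h2⟩
    · ext <;> simp <;> nlinarith


theorem norm_sub_sq_H (a b : H) : ‖a - b‖ ^ 2 = ‖a‖ ^ 2 + ‖b‖ ^ 2 - 2 * (a * star b).re := by
  have := norm_sub_sq_real a b
  rw [Quaternion.inner_def] at this
  linarith

theorem norm_add_sq_H (a b : H) : ‖a + b‖ ^ 2 = ‖a‖ ^ 2 + ‖b‖ ^ 2 + 2 * (a * star b).re := by
  have := norm_add_sq_real a b
  rw [Quaternion.inner_def] at this
  linarith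

theorem re_star_H (a : H) : (star a).re = a.re := Quaternion.re_star a

theorem re_mul_comm_H (a b : H) : (a * b).re = (b * a).re := by
  simp only [Quaternion.re_mul]; ring

theorem id_one (y u w : H) :
    ‖y + u * w‖ ^ 2 - ‖u + y * star w‖ ^ 2 = (‖y‖ ^ 2 - ‖u‖ ^ 2) * (1 - ‖w‖ ^ 2) := by
  rw [norm_add_sq_H, norm_add_sq_H, ← re_star_H (y * star (u * w))]
  simp only [star_mul, star_star, norm_mul, norm_star, mul_assoc]
  ring

theorem id_two (q t p : H) :
    ‖t - q * t * star p‖ ^ 2 - ‖q * t - t * p‖ ^ 2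
      = ‖t‖ ^ 2 * ((1 - ‖q‖ ^ 2) * (1 - ‖p‖ ^ 2)) := by
  rw [norm_sub_sq_H, norm_sub_sq_H, ← re_star_H (t * star (q * t * star p))]
  simp only [star_mul, star_star, norm_mul, norm_star, mul_assoc]
  ring

theorem id_three (v p s : H) : ‖v - star p * v * s‖ ^ 2 = ‖v - p * v * star s‖ ^ 2 := by
  rw [norm_sub_sq_H, norm_sub_sq_H, ← re_star_H (v * star (p * v * star s))]
  simp only [star_mul, star_star, norm_mul, norm_star, mul_assoc]
  rw [re_mul_comm_H p]
  simp only [mul_assoc]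

theorem exists_sylv {q p : H} (h : ‖q‖ ≠ ‖p‖) (v : H) : ∃ t, q * t - t * p = v := by
  let T : H →ₗ[ℝ] H := LinearMap.mulLeft ℝ q - LinearMap.mulRight ℝ p
  have hinj : Function.Injective T := by
    rw [injective_iff_map_eq_zero]
    intro t ht
    have h1 : q * t = t * p := sub_eq_zero.1 (by simpa [T] using ht)
    by_contra h0
    apply h
    have h2 := congrArg norm h1
    rw [norm_mul, norm_mul, mul_comm] at h2
    exact mul_left_cancel₀ (norm_ne_zero_iff.2 h0) h2
  obtain ⟨t, ht⟩ := (LinearMap.injective_iff_surjective.1 hinj) v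
  exact ⟨t, by simpa [T] using ht⟩

theorem exists_sylv' {q p : H} (hq : ‖q‖ < 1) (hp : ‖p‖ < 1) (v : H) :
    ∃ t, t - q * t * p = v := by
  let T : H →ₗ[ℝ] H := LinearMap.id - (LinearMap.mulRight ℝ p).comp (LinearMap.mulLeft ℝ q)
  have hinj : Function.Injective T := by
    rw [injective_iff_map_eq_zero]
    intro t ht
    have h1 : t = q * t * p := sub_eq_zero.1 (by simpa [T] using ht)
    by_contra h0
    have h2 := congrArg norm h1
    rw [norm_mul, norm_mul] at h2
    have h3 : 0 < ‖t‖ := norm_pos_iff.2 h0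
    have h4 : ‖q‖ * ‖p‖ < 1 := by nlinarith [norm_nonneg q, norm_nonneg p]
    nlinarith
  obtain ⟨t, ht⟩ := (LinearMap.injective_iff_surjective.1 hinj) v
  exact ⟨t, by simpa [T] using ht⟩

theorem AS_of_bdd' {f : PowerSeries H}
    (h : ∀ s : ℝ, 0 < s → s < 1 → ∃ C, ∀ m, s ^ m * ‖coeff m f‖ ≤ C) : AS f := by
  intro r h0 h1
  obtain ⟨s, hs1, hs2⟩ := exists_between h1
  have hs0 : 0 < s := h0.trans_lt hs1
  obtain ⟨C, hC⟩ := h s hs0 hs2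
  refine Summable.of_nonneg_of_le (fun m => by positivity) (fun m => ?_)
    ((summable_geometric_of_lt_one (r := r / s) (by positivity)
      ((div_lt_one hs0).2 hs1)).mul_right C)
  calc r ^ m * ‖coeff m f‖ = (r / s) ^ m * (s ^ m * ‖coeff m f‖) := by
        rw [div_pow]; field_simp
    _ ≤ _ := mul_le_mul_of_nonneg_left (hC m) (by positivity)

theorem diffQuot_aux {a : ℕ → H} (ha : AS (PowerSeries.mk a)) {p : H} (hp : ‖p‖ < 1)
    {s : ℝ} (hs0 : 0 < s) (hs : s < 1) : ∃ s' C : ℝ, 0 < s' ∧ s < s' ∧ ‖p‖ < s' ∧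
      ∀ m k, ‖p ^ k * a (k + m + 1)‖ ≤ (‖p‖ / s') ^ k * (C / s' ^ (m + 1)) := by
  obtain ⟨s', h1, h2⟩ := exists_between (max_lt hs hp)
  have hs'0 : 0 < s' := hs0.trans ((le_max_left _ _).trans_lt h1)
  obtain ⟨C, hC⟩ := (ha s' hs'0.le h2).tendsto_atTop_zero.bddAbove_range
  refine ⟨s', C, hs'0, (le_max_left _ _).trans_lt h1, (le_max_right _ _).trans_lt h1, ?_⟩
  intro m k
  have hc : s' ^ (k + m + 1) * ‖a (k + m + 1)‖ ≤ C := by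
    have := hC ⟨k + m + 1, rfl⟩
    simpa using this
  calc ‖p ^ k * a (k + m + 1)‖
      = ‖p‖ ^ k * (s' ^ (k + m + 1) * ‖a (k + m + 1)‖) / s' ^ (k + (m + 1)) := by
        rw [norm_mul, norm_pow, ← add_assoc]; field_simp
    _ ≤ ‖p‖ ^ k * C / s' ^ (k + (m + 1)) := by gcongr
    _ = _ := by rw [div_pow, pow_add]; field_simp

theorem diffQuot_summable {a : ℕ → H} (ha : AS (PowerSeries.mk a)) {p : H} (hp : ‖p‖ < 1)
    (m : ℕ) : Summable fun k => p ^ k * a (k + m + 1) := by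
  obtain ⟨s', C, h0, -, h2, h3⟩ := diffQuot_aux ha hp (s := 1 / 2) (by norm_num) (by norm_num)
  refine Summable.of_norm_bounded ?_ (h3 m)
  exact (summable_geometric_of_lt_one (by positivity) ((div_lt_one h0).2 h2)).mul_right _

theorem diffQuot_AS {a : ℕ → H} (ha : AS (PowerSeries.mk a)) {p : H} (hp : ‖p‖ < 1) :
    AS (PowerSeries.mk (diffQuotC a p)) := by
  apply AS_of_bdd'
  intro s hs0 hs
  obtain ⟨s', C, h0, h1, h2, h3⟩ := diffQuot_aux ha hp hs0 hs
  have hC : 0 ≤ C := by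
    have h4 := (norm_nonneg _).trans (h3 0 0)
    rw [pow_zero, one_mul] at h4
    by_contra hc
    exact absurd h4 (not_le.2 (div_neg_of_neg_of_pos (not_le.1 hc) (by positivity)))
  have hg := hasSum_geometric_of_lt_one (r := ‖p‖ / s') (by positivity) ((div_lt_one h0).2 h2)
  have hpos : 0 ≤ (1 - ‖p‖ / s')⁻¹ := by
    rw [inv_nonneg, sub_nonneg]; exact ((div_lt_one h0).2 h2).le
  refine ⟨(1 - ‖p‖ / s')⁻¹ * (C / s'), fun m => ?_⟩
  have h5 := tsum_of_norm_bounded (hg.mul_right (C / s' ^ (m + 1))) (h3 m)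
  rw [coeff_mk, diffQuotC]
  calc s ^ m * ‖∑' k, p ^ k * a (k + m + 1)‖
      ≤ s' ^ m * ((1 - ‖p‖ / s')⁻¹ * (C / s' ^ (m + 1))) := by gcongr
    _ = _ := by rw [pow_succ]; field_simp

theorem diffQuot_eq {a : ℕ → H} (ha : AS (PowerSeries.mk a)) {p : H} (hp : ‖p‖ < 1) :
    (X - C p) * PowerSeries.mk (diffQuotC a p) = PowerSeries.mk a - C (evalC a p) := by
  ext1 n
  rw [sub_mul, map_sub, map_sub, coeff_C_mul]
  cases n with
  | zero =>
    have hs : Summable fun k => p ^ k * a k := by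
      simpa using ha.summable hp 1
    rw [coeff_zero_X_mul, coeff_mk, coeff_mk, coeff_zero_C, evalC, hs.tsum_eq_zero_add, diffQuotC,
      ← tsum_mul_left]
    simp [pow_succ', mul_assoc]
  | succ n =>
    rw [coeff_succ_X_mul, coeff_mk, coeff_mk, coeff_mk, coeff_C, diffQuotC, diffQuotC,
      (diffQuot_summable ha hp n).tsum_eq_zero_add, ← tsum_mul_left]
    have : ∀ k, k + 1 + n + 1 = k + (n + 1) + 1 := fun k => by omega
    simp [pow_succ', mul_assoc, this]

/-- the contraction property -/
def Contr (f : PowerSeries H) : Prop := ∀ q : H, ‖q‖ < 1 → ∀ v, ‖ev f q v‖ ≤ ‖v‖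

theorem contr_of_selfMap {a : ℕ → H} (ha : SelfMap a) : Contr (PowerSeries.mk a) := by
  intro q hq v
  by_cases hv : v = 0
  · simp [hv, ev_zero_right]
  rw [ev_conj _ _ _ hv, norm_mul, ← evalC_eq_ev]
  have hq' : ‖v⁻¹ * q * v‖ < 1 := by
    rw [norm_mul, norm_mul, norm_inv, mul_right_comm, inv_mul_cancel₀ (norm_ne_zero_iff.2 hv),
      one_mul]; exact hq
  have := (ha.2 _ hq').le
  nlinarith [norm_nonneg v]

theorem cauchy_one {f : PowerSeries H} (hf : AS f) {K : ℝ}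
    (h : ∀ q : H, ‖q‖ < 1 → ‖ev f q 1‖ ≤ K) (m : ℕ) : ‖coeff m f‖ ≤ K := by
  have h1 := cauchy_bd hf 1 K (fun z hz => h z (by rwa [norm_coeComplex])) m
  rwa [one_mul] at h1

set_option maxHeartbeats 1000000 in
theorem exists_inv {f : PowerSeries H} (hf : AS f) (hc : Contr f) {w : H} (hw : ‖w‖ < 1) :
    ∃ S : PowerSeries H, AS S ∧ (1 - C (star w) * f) * S = 1 := by
  set G := C (star w) * f with hG
  have hGA : AS G := (AS_C _).mul hf
  have hGn : ∀ n, AS (G ^ n) := by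
    intro n
    induction n with
    | zero => simpa using AS_one
    | succ n ih => rw [pow_succ]; exact ih.mul hGA
  have hb : ∀ n, ∀ q : H, ‖q‖ < 1 → ∀ v, ‖ev (G ^ n) q v‖ ≤ ‖w‖ ^ n * ‖v‖ := by
    intro n q hq
    induction n with
    | zero => intro v; simp [ev_one]
    | succ n ih =>
      intro v
      rw [pow_succ, ev_mul (hGn n) hGA hq, hG, ev_mul (AS_C _) hf hq, ev_C]
      refine (hc q hq _).trans ?_
      rw [norm_mul, norm_star, pow_succ]
      nlinarith [ih v, norm_nonneg w]
  have hcf : ∀ m n, ‖coeff m (G ^ n)‖ ≤ ‖w‖ ^ n := by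
    intro m n
    refine cauchy_one (hGn n) (fun q hq => ?_) m
    have h1 := hb n q hq 1
    rwa [norm_one, mul_one] at h1
  have hgeo := hasSum_geometric_of_lt_one (norm_nonneg w) hw
  have hsum : ∀ m, Summable fun n => coeff m (G ^ n) := fun m =>
    Summable.of_norm_bounded hgeo.summable (hcf m)
  refine ⟨PowerSeries.mk fun m => ∑' n, coeff m (G ^ n), ?_, ?_⟩
  · apply AS_of_bdd (C := (1 - ‖w‖)⁻¹)
    intro m
    rw [coeff_mk]
    exact tsum_of_norm_bounded hgeo (hcf m)
  · ext1 m
    rw [sub_mul, one_mul, map_sub, coeff_mk, coeff_mul]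
    have : ∑ x ∈ Finset.HasAntidiagonal.antidiagonal m, coeff x.1 G *
        coeff x.2 (PowerSeries.mk fun m => ∑' n, coeff m (G ^ n)) = ∑' n, coeff m (G ^ (n + 1)) := by
      simp only [coeff_mk, ← tsum_mul_left]
      have hsm : ∀ x ∈ Finset.HasAntidiagonal.antidiagonal m,
          Summable fun n => coeff x.1 G * coeff x.2 (G ^ n) :=
        fun x _ => (hsum x.2).mul_left (coeff x.1 G)
      rw [← Summable.tsum_finsetSum hsm]
      congr 1; ext1 n
      rw [pow_succ', coeff_mul]
    rw [this, (hsum m).tsum_eq_zero_add]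
    simp


theorem mk_oneMinus (p : H) : PowerSeries.mk (oneMinusQPbarC p) = 1 - X * C (star p) := by
  ext1 n
  rw [coeff_mk, map_sub, coeff_one, coeff_mul_C, coeff_X, oneMinusQPbarC]
  match n with
  | 0 => simp
  | 1 => simp
  | n + 2 => simp

theorem mk_qMinus (p : H) : PowerSeries.mk (qMinusPC p) = X - C p := by
  ext1 n
  rw [coeff_mk, map_sub, coeff_X, coeff_C, qMinusPC]
  match n with
  | 0 => simp
  | 1 => simp
  | n + 2 => simp

theorem step_bound {f R h : PowerSeries H} {p w : H} (hf : AS f) (hc : Contr f) (hR : AS R)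
    (hh : AS h) (hw : ‖w‖ < 1) (hp : ‖p‖ < 1) (hRq : (X - C p) * R = f - C w)
    (hhD : h * (1 - C (star w) * f) = (1 - X * C (star p)) * R)
    {q : H} (hpq : ‖p‖ < ‖q‖) (hq : ‖q‖ < 1) (v : H) :
    ‖ev h q v‖ ^ 2 ≤ ‖v‖ ^ 2 * (1 + (1 - ‖q‖ ^ 2) * (1 - ‖p‖ ^ 2) / (‖q‖ - ‖p‖) ^ 2) := by
  obtain ⟨t, ht⟩ := exists_sylv hpq.ne' v
  set u := t - q * t * star p with hu
  set y := ev h q v with hy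
  have hpp : star p * p = p * star p := by
    rw [Quaternion.star_mul_self, Quaternion.self_mul_star]
  have hcomm : v - q * v * star p = q * u - u * p := by
    have h1 : t * star p * p = t * p * star p := by rw [mul_assoc, hpp, mul_assoc]
    rw [hu, ← ht]
    simp only [mul_sub, sub_mul, mul_assoc] at *
    rw [h1]; abel
  have hASG : AS (C (star w) * f) := (AS_C _).mul hf
  have h1 : ev (h * (1 - C (star w) * f)) q v = y - ev f q (y * star w) := by
    rw [ev_mul hh (AS_one.sub hASG) hq, ev_sub AS_one hASG hq, ev_one, ev_mul (AS_C _) hf hq, ev_C]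
  have hASp : AS (X * C (star p)) := AS_X.mul (AS_C _)
  have h2 : ev ((1 - X * C (star p)) * R) q v = ev R q (v - q * v * star p) := by
    rw [ev_mul (AS_one.sub hASp) hR hq, ev_sub AS_one hASp hq, ev_one, ev_mul AS_X (AS_C _) hq,
      ev_X, ev_C]
  have h3 : ev ((X - C p) * R) q u = ev R q (q * u - u * p) := by
    rw [ev_mul (AS_X.sub (AS_C _)) hR hq, ev_sub AS_X (AS_C _) hq, ev_X, ev_C]
  have h4 : ev (f - C w) q u = ev f q u - u * w := by
    rw [ev_sub hf (AS_C _) hq, ev_C]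
  have h5 : y - ev f q (y * star w) = ev f q u - u * w := by
    rw [← h1, hhD, h2, hcomm, ← h3, hRq, h4]
  have hadd : ev f q (u + y * star w) = ev f q u + ev f q (y * star w) := by
    simp only [ev]
    rw [← (hf.summable hq u).tsum_add (hf.summable hq _)]
    simp only [mul_add, add_mul]
  have h6 : y + u * w = ev f q (u + y * star w) := by
    rw [hadd]
    have := h5
    rw [sub_eq_sub_iff_add_eq_add] at this
    exact this
  have h7 : ‖y + u * w‖ ≤ ‖u + y * star w‖ := by rw [h6]; exact hc q hq _
  have h8 : ‖y + u * w‖ ^ 2 ≤ ‖u + y * star w‖ ^ 2 := by gcongr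
  have h9 := id_one y u w
  have hw2 : 0 < 1 - ‖w‖ ^ 2 := by nlinarith [norm_nonneg w]
  have h10 : ‖y‖ ^ 2 ≤ ‖u‖ ^ 2 := by
    by_contra hcon
    have := mul_pos (sub_pos.2 (not_le.1 hcon)) hw2
    linarith
  have h11 := id_two q t p
  rw [← hu, ht] at h11
  have h12 : (‖q‖ - ‖p‖) * ‖t‖ ≤ ‖v‖ := by
    rw [← ht]
    have := norm_sub_norm_le (q * t) (t * p)
    rw [norm_mul, norm_mul] at this
    linarith
  have hd : 0 < ‖q‖ - ‖p‖ := sub_pos.2 hpq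
  have h13 : ‖t‖ ^ 2 ≤ ‖v‖ ^ 2 / (‖q‖ - ‖p‖) ^ 2 := by
    rw [le_div_iff₀ (by positivity), ← mul_pow, mul_comm]
    gcongr
  have hq2 : 0 ≤ 1 - ‖q‖ ^ 2 := by nlinarith [norm_nonneg q]
  have hp2 : 0 ≤ 1 - ‖p‖ ^ 2 := by nlinarith [norm_nonneg p]
  have h14 := mul_le_mul_of_nonneg_right h13 (mul_nonneg hq2 hp2)
  calc ‖y‖ ^ 2 ≤ ‖v‖ ^ 2 + ‖v‖ ^ 2 / (‖q‖ - ‖p‖) ^ 2 * ((1 - ‖q‖ ^ 2) * (1 - ‖p‖ ^ 2)) := by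
        linarith
    _ = _ := by ring

theorem limit_bound {f R h : PowerSeries H} {p w : H} (hf : AS f) (hc : Contr f) (hR : AS R)
    (hh : AS h) (hw : ‖w‖ < 1) (hp : ‖p‖ < 1) (hRq : (X - C p) * R = f - C w)
    (hhD : h * (1 - C (star w) * f) = (1 - X * C (star p)) * R)
    (z : ℂ) (hz : ‖z‖ < 1) (v : H) : ‖ev h z v‖ ≤ ‖v‖ := by
  set B : ℝ → ℝ := fun r => ‖v‖ ^ 2 * (1 + (1 - r ^ 2) * (1 - ‖p‖ ^ 2) / (r - ‖p‖) ^ 2) with hB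
  have ht : Filter.Tendsto B (nhdsWithin 1 (Set.Iio 1)) (nhds (B 1)) := by
    apply tendsto_nhdsWithin_of_tendsto_nhds
    have : ContinuousAt B 1 := by
      have hne : ((1 : ℝ) - ‖p‖) ^ 2 ≠ 0 := pow_ne_zero _ (sub_pos.2 hp).ne'
      apply ContinuousAt.mul continuousAt_const
      apply ContinuousAt.add continuousAt_const
      exact ContinuousAt.div (by fun_prop) (by fun_prop) hne
    exact this
  have hB1 : B 1 = ‖v‖ ^ 2 := by simp [hB]
  rw [hB1] at ht
  have : ‖ev h z v‖ ^ 2 ≤ ‖v‖ ^ 2 := by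
    refine ge_of_tendsto ht ?_
    filter_upwards [Ioo_mem_nhdsLT (max_lt hz hp)] with r hr
    have hzr : ‖z‖ < r := (le_max_left _ _).trans_lt hr.1
    have hpr : ‖p‖ < r := (le_max_right _ _).trans_lt hr.1
    have hr0 : 0 < r := (norm_nonneg _).trans_lt hzr
    have hb : ∀ x : ℂ, ‖x‖ = r → ‖ev h x v‖ ^ 2 ≤ B r := by
      intro x hx
      have hx' : ‖(x : H)‖ = r := by rw [norm_coeComplex, hx]
      have := step_bound hf hc hR hh hw hp hRq hhD (q := x) (by rw [hx']; exact hpr)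
        (by rw [hx']; exact hr.2) v
      rw [hx'] at this
      exact this
    have h1 := max_bd hh v (Real.sqrt (B r)) hr0 hr.2
      (fun x hx => Real.le_sqrt_of_sq_le (hb x hx)) z hzr.le
    have hBr : 0 ≤ B r := (sq_nonneg _).trans (hb (r : ℂ) (by simp [abs_of_pos hr0]))
    calc ‖ev h z v‖ ^ 2 ≤ (Real.sqrt (B r)) ^ 2 := by gcongr
      _ = B r := Real.sq_sqrt hBr
  exact le_of_sq_le_sq this (norm_nonneg _)

theorem ev_of_conj (h : PowerSeries H) {q v : H} {z : ℂ} (hv : v ≠ 0) (hz : (z : H) * v = v * q) :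
    ev h z v = v * ev h q 1 := by
  rw [ev_conj _ _ _ hv]
  have : v⁻¹ * (z : H) * v = q := by rw [mul_assoc, hz]; rw [inv_mul_cancel_left₀ hv]
  rw [this]

theorem norm_of_conj {q v : H} {z : ℂ} (hv : v ≠ 0) (hz : (z : H) * v = v * q) :
    ‖z‖ = ‖q‖ := by
  have := congrArg norm hz
  rw [norm_mul, norm_mul, norm_coeComplex, mul_comm] at this
  exact mul_left_cancel₀ (norm_ne_zero_iff.2 hv) this

theorem ring_one {K : Type*} [Ring K] (x p pb U w wb f : K) :
    (x - p) * (U * (1 - wb * f)) = (1 - x * pb) * (f - w) ↔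
    ((1 - p * U * wb) - x * (pb - U * wb)) * f = x * (U - pb * w) - (p * U - w) := by
  rw [← sub_eq_zero, ← sub_eq_zero (a := ((1 - p * U * wb) - x * (pb - U * wb)) * f)]
  have : (x - p) * (U * (1 - wb * f)) - (1 - x * pb) * (f - w) =
    -(((1 - p * U * wb) - x * (pb - U * wb)) * f - (x * (U - pb * w) - (p * U - w))) := by
    noncomm_ring
  rw [this, neg_eq_zero]

theorem mob_equiv {f : PowerSeries H} {p w U A t u : H} (hA : A ≠ 0) (h0 : 1 - p * U * star w = A)
    (h1 : star p - U * star w = A * star t) (h2 : U - star p * w = A * u)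
    (h3 : p * U - w = A * t * u) :
    (X - C p) * (C U * (1 - C (star w) * f)) = (1 - X * C (star p)) * (f - C w) ↔
    (1 - X * C (star t)) * f = (X - C t) * C u := by
  rw [ring_one]
  have e0 : (1 : PowerSeries H) - C p * C U * C (star w) = C A := by
    rw [← h0]; simp
  have e1 : C (star p) - C U * C (star w) = C A * C (star t) := by
    rw [← map_mul, ← map_mul, ← map_sub, h1]
  have e2 : C U - C (star p) * C w = C A * C u := by
    rw [← map_mul, ← map_mul, ← map_sub, h2]
  have e3 : C p * C U - C w = C A * C t * C u := by
    rw [← map_mul, ← map_mul, ← map_mul, ← map_sub, h3]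
  rw [e0, e1, e2, e3]
  have x1 : ∀ y : PowerSeries H, X * (C A * y) = C A * (X * y) := fun y => by
    rw [← mul_assoc, X_mul, mul_assoc]
  have l1 : (C A - X * (C A * C (star t))) * f = C A * ((1 - X * C (star t)) * f) := by
    rw [x1]; noncomm_ring
  have l2 : X * (C A * C u) - C A * C t * C u = C A * ((X - C t) * C u) := by
    rw [x1]; noncomm_ring
  rw [l1, l2]
  constructor
  · intro h
    have := congrArg (fun y => C A⁻¹ * y) h
    simp only [← mul_assoc] at this
    rw [← map_mul, inv_mul_cancel₀ hA] at this
    simpa only [map_one, one_mul] using this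
  · intro h; rw [h]

theorem isBlaschke_one (a : ℕ → H) : IsBlaschke a 1 ↔ ∃ t u : H, ‖t‖ < 1 ∧ ‖u‖ = 1 ∧
    (1 - X * C (star t)) * PowerSeries.mk a = (X - C t) * C u := by
  have hone : PowerSeries.mk (fun m => if m = 0 then (1 : H) else 0) = 1 := by
    ext1 n; rw [coeff_mk, coeff_one]
  have hb : ∀ t u : H, PowerSeries.mk (fun m => blaschkeListC [t] m * u) =
      PowerSeries.mk (starInvC (oneMinusQPbarC t)) * ((X - C t) * C u) := by
    intro t u
    have h1 : PowerSeries.mk (fun m => blaschkeListC [t] m * u) =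
        PowerSeries.mk (blaschkeListC [t]) * C u := by
      ext1 n; rw [coeff_mul_C, coeff_mk, coeff_mk]
    rw [h1, blaschkeListC, blaschkeListC, mk_starMulC, hone, mul_one, mobiusC, mk_starMulC,
      mk_qMinus, mul_assoc]
  have h0 : ∀ t : H, oneMinusQPbarC t 0 ≠ 0 := fun t => by simp [oneMinusQPbarC]
  constructor
  · rintro ⟨ts, u, hl, ht, hu, rfl⟩
    obtain ⟨t, rfl⟩ := List.length_eq_one_iff.1 hl
    refine ⟨t, u, ht t (by simp), hu, ?_⟩
    rw [hb, ← mul_assoc, ← mk_oneMinus, mk_mul_starInvC _ (h0 t), one_mul]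
  · rintro ⟨t, u, ht, hu, h⟩
    refine ⟨[t], u, rfl, by simpa using ht, hu, ?_⟩
    have : PowerSeries.mk a = PowerSeries.mk (fun m => blaschkeListC [t] m * u) := by
      rw [hb, ← h, ← mul_assoc, ← mk_oneMinus, starInvC_mul_mk _ (h0 t), one_mul]
    ext1 m
    have h2 := congrArg (coeff m) this
    rwa [coeff_mk, coeff_mk] at h2

theorem swap_comm (p : H) : (X - C p) * (1 - X * C (star p)) = (1 - X * C (star p)) * (X - C p) := by
  have hpp : C (star p) * C p = C p * C (star p) := by
    rw [← map_mul, ← map_mul, Quaternion.star_mul_self, Quaternion.self_mul_star]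
  have h1 : C p * (X * C (star p)) = X * (C p * C (star p)) := by
    rw [← mul_assoc, ← X_mul, mul_assoc]
  have h2 : X * C (star p) * X = X * (X * C (star p)) := by
    rw [mul_assoc, ← X_mul]
  rw [sub_mul, sub_mul, mul_sub, mul_sub, mul_sub, mul_sub, h1, h2, mul_assoc X (C (star p)) (C p),
    hpp]
  noncomm_ring

theorem alg_forward {p w U : H} (hp : ‖p‖ < 1) (hw : ‖w‖ < 1) (hU : ‖U‖ = 1) :
    ∃ A t u : H, A ≠ 0 ∧ ‖t‖ < 1 ∧ ‖u‖ = 1 ∧ 1 - p * U * star w = A ∧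
      star p - U * star w = A * star t ∧ U - star p * w = A * u ∧ p * U - w = A * t * u := by
  set A := 1 - p * U * star w with hA
  have hpw : ‖p‖ ^ 2 < 1 := by nlinarith [norm_nonneg p]
  have hww : ‖w‖ ^ 2 < 1 := by nlinarith [norm_nonneg w]
  have nA : ‖A‖ ^ 2 = 1 + ‖p‖ ^ 2 * ‖w‖ ^ 2 - 2 * (p * (U * star w)).re := by
    rw [hA, norm_sub_sq_H, one_mul, re_star_H]
    simp only [norm_mul, norm_star, norm_one, hU, mul_assoc]; ring
  have n1 : ‖star p - U * star w‖ ^ 2 = ‖p‖ ^ 2 + ‖w‖ ^ 2 - 2 * (p * (U * star w)).re := by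
    rw [norm_sub_sq_H, ← re_star_H (star p * _)]
    simp only [norm_mul, norm_star, hU, star_mul, star_star]
    rw [re_mul_comm_H]; ring
  have n2 : ‖U - star p * w‖ ^ 2 = ‖A‖ ^ 2 := by
    rw [nA, norm_sub_sq_H, re_mul_comm_H p]
    simp only [norm_mul, norm_star, hU, star_mul, star_star, mul_assoc]; ring
  have hlt : ‖star p - U * star w‖ ^ 2 < ‖A‖ ^ 2 := by
    rw [nA, n1]; nlinarith [mul_pos (sub_pos.2 hpw) (sub_pos.2 hww)]
  have hA0 : A ≠ 0 := by
    intro h; rw [h, norm_zero] at hlt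
    have := sq_nonneg ‖star p - U * star w‖
    norm_num at hlt
    linarith
  have hAn : 0 < ‖A‖ := norm_pos_iff.2 hA0
  refine ⟨A, star (A⁻¹ * (star p - U * star w)), A⁻¹ * (U - star p * w), hA0, ?_, ?_, rfl, ?_, ?_,
    ?_⟩
  · rw [norm_star, norm_mul, norm_inv, inv_mul_lt_iff₀ hAn, mul_one]
    exact lt_of_pow_lt_pow_left₀ 2 hAn.le hlt
  · rw [norm_mul, norm_inv, inv_mul_eq_one₀ hAn.ne']
    exact ((pow_left_inj₀ (norm_nonneg _) (norm_nonneg _) two_ne_zero).1 n2).symm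
  · rw [star_star, mul_inv_cancel_left₀ hA0]
  · rw [mul_inv_cancel_left₀ hA0]
  · have hUU : star U * U = 1 := by
      rw [Quaternion.star_mul_self, Quaternion.normSq_eq_norm_mul_self, hU]; simp
    set n : H := ((Quaternion.normSq p : ℝ) : H) with hn
    have hp1 : p * star p = n := Quaternion.self_mul_star p
    have hp2 : star p * p = n := Quaternion.star_mul_self p
    have hnc : ∀ y : H, n * y = y * n := fun y => Quaternion.coe_commutes _ y
    have hsA : star A = 1 - w * star U * star p := by
      rw [hA]; simp [star_mul, mul_assoc]
    have key : (p - w * star U) * (U - star p * w) = star A * (p * U - w) := by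
      rw [hsA]
      have l : (p - w * star U) * (U - star p * w)
          = p * U - (p * star p) * w - w * (star U * U) + w * star U * star p * w := by noncomm_ring
      have r : (1 - w * star U * star p) * (p * U - w)
          = p * U - w - w * star U * (star p * p) * U + w * star U * star p * w := by noncomm_ring
      have e : w * star U * n * U = n * w := by
        rw [mul_assoc, hnc U, ← mul_assoc, mul_assoc w, hUU, mul_one, hnc]
      rw [l, r, hp1, hp2, hUU, e]; noncomm_ring
    have hst : star (A⁻¹ * (star p - U * star w)) = (p - w * star U) * (star A)⁻¹ := by
      simp [star_mul, star_sub, star_inv₀]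
    rw [hst]
    have hsA0 : star A ≠ 0 := star_ne_zero.2 hA0
    have hc : A * star A = star A * A := by
      rw [Quaternion.star_mul_self, Quaternion.self_mul_star]
    set m : H := ((Quaternion.normSq A : ℝ) : H) with hm
    have hm1 : A * star A = m := Quaternion.self_mul_star A
    have hm0 : m ≠ 0 := by rw [← hm1]; exact mul_ne_zero hA0 hsA0
    have hmc : ∀ y : H, m * y = y * m := fun y => Quaternion.coe_commutes _ y
    have hinv : (star A)⁻¹ * A⁻¹ = m⁻¹ := by rw [← hm1, mul_inv_rev]
    have hmi : ∀ y : H, m⁻¹ * y = y * m⁻¹ := fun y => by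
      have : Commute m y := hmc y
      exact this.inv_left₀
    calc p * U - w = m⁻¹ * (A * star A * (p * U - w)) := by rw [hm1, inv_mul_cancel_left₀ hm0]
      _ = m⁻¹ * (A * ((p - w * star U) * (U - star p * w))) := by rw [mul_assoc A, ← key]
      _ = A * ((p - w * star U) * m⁻¹) * (U - star p * w) := by
        rw [← mul_assoc, hmi A, mul_assoc, ← mul_assoc m⁻¹, hmi (p - w * star U)]
        simp only [mul_assoc]
      _ = _ := by rw [← hinv]; simp only [mul_assoc]

theorem alg_back {p t u v w U : H} (hp : ‖p‖ < 1) (hu : ‖u‖ = 1) (hv : v - p * v * star t = 1)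
    (hw : w = (p * v - v * t) * u) (hU : U = (v - star p * v * t) * u) :
    ∃ A : H, A ≠ 0 ∧ ‖U‖ = 1 ∧ 1 - p * U * star w = A ∧
      star p - U * star w = A * star t ∧ U - star p * w = A * u ∧ p * U - w = A * t * u := by
  set n : H := ((Quaternion.normSq p : ℝ) : H) with hn
  have hp1 : p * star p = n := Quaternion.self_mul_star p
  have hp2 : star p * p = n := Quaternion.star_mul_self p
  have huu : u * star u = 1 := by
    rw [Quaternion.self_mul_star, Quaternion.normSq_eq_norm_mul_self, hu]; simp
  have hvs : star v - t * star v * star p = 1 := by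
    have := congrArg star hv
    simpa [star_mul, mul_assoc] using this
  have hW : U * star w = star p * v - v * star t := by
    have hvv : v * star v = ((Quaternion.normSq v : ℝ) : H) := Quaternion.self_mul_star v
    have htt : star t * t = t * star t := by
      rw [Quaternion.star_mul_self, Quaternion.self_mul_star]
    have htn : t * star t = ((Quaternion.normSq t : ℝ) : H) := Quaternion.self_mul_star t
    have l : U * star w = (v - star p * v * t) * (star v * star p - star t * star v) := by
      rw [hU, hw, star_mul, star_sub, star_mul, star_mul]
      rw [mul_assoc, ← mul_assoc u, huu, one_mul]
    have r : star p * v - v * star t = (star p * v - v * star t) * (star v - t * star v * star p) := by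
      rw [hvs, mul_one]
    rw [l, r]
    have l2 : (v - star p * v * t) * (star v * star p - star t * star v) =
      (v * star v) * star p - v * star t * star v - star p * v * t * star v * star p
        + star p * (v * (t * star t) * star v) := by noncomm_ring
    have r2 : (star p * v - v * star t) * (star v - t * star v * star p) =
      star p * (v * star v) - star p * v * t * star v * star p - v * star t * star v
        + v * (star t * t) * star v * star p := by noncomm_ring
    have e : v * ((Quaternion.normSq t : ℝ) : H) * star v
        = ((Quaternion.normSq t * Quaternion.normSq v : ℝ) : H) := by
      rw [← Quaternion.coe_commutes, mul_assoc, hvv, ← Quaternion.coe_mul]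
    rw [l2, r2, htt, htn, hvv, e, Quaternion.coe_commutes, Quaternion.coe_commutes]
    abel
  have hv0 : v ≠ 0 := by rintro rfl; simp at hv
  have hA : 1 - p * U * star w = v - n * v := by
    rw [mul_assoc, hW, mul_sub, ← mul_assoc, hp1]
    nth_rewrite 1 [← hv]
    simp only [mul_assoc]; abel
  have hpn : Quaternion.normSq p < 1 := by
    rw [Quaternion.normSq_eq_norm_mul_self]; nlinarith [norm_nonneg p]
  refine ⟨v - n * v, ?_, ?_, hA, ?_, ?_, ?_⟩
  · have : v - n * v = ((1 - Quaternion.normSq p : ℝ) : H) * v := by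
      rw [Quaternion.coe_sub, sub_mul]; simp [hn]
    rw [this]
    refine mul_ne_zero ?_ hv0
    intro h
    have h2 : (1 - Quaternion.normSq p : ℝ) = 0 := by
      have h3 := congrArg (fun x : H => x.re) h
      rw [Quaternion.re_coe, Quaternion.re_zero] at h3
      exact h3
    linarith
  · have := id_three v p t
    rw [hv, norm_one, one_pow] at this
    rw [hU, norm_mul, hu, mul_one]
    exact (pow_eq_one_iff_of_nonneg (norm_nonneg _) two_ne_zero).1 this
  · rw [hW]
    have : star p = star p * v - n * v * star t := by
      calc star p = star p * (v - p * v * star t) := by rw [hv, mul_one]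
        _ = star p * v - (star p * p) * v * star t := by noncomm_ring
        _ = _ := by rw [hp2]
    nth_rewrite 1 [this]
    noncomm_ring
  · rw [hU, hw, ← hp2]; noncomm_ring
  · rw [hU, hw, ← hp1]; noncomm_ring



theorem main_setup (a : ℕ → H) (ha : SelfMap a) (p : H) (hp : ‖p‖ < 1) :
    AS (PowerSeries.mk a) ∧ AS (PowerSeries.mk (diffQuotC a p)) ∧ AS (PowerSeries.mk (hdqC a p)) ∧
    PowerSeries.mk (hdqC a p) * (1 - C (star (evalC a p)) * PowerSeries.mk a) =
      (1 - X * C (star p)) * PowerSeries.mk (diffQuotC a p) ∧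
    ∃ S, (1 - C (star (evalC a p)) * PowerSeries.mk a) * S = 1 := by
  have hf : AS (PowerSeries.mk a) := AS_of_summableOn ha.1
  have hR := diffQuot_AS hf hp
  obtain ⟨S, hS, hS1⟩ := exists_inv hf (contr_of_selfMap ha) (ha.2 p hp)
  set w := evalC a p with hw
  set d : ℕ → H := fun m => (if m = 0 then (1 : H) else 0) - star w * a m with hd
  have hmd : PowerSeries.mk d = 1 - C (star w) * PowerSeries.mk a := by
    ext1 n
    rw [map_sub, coeff_C_mul, coeff_mk, coeff_mk, coeff_one]
  have hd0 : d 0 ≠ 0 := by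
    intro h0
    rw [← hmd] at hS1
    have := congrArg (coeff 0) hS1
    rw [coeff_mul] at this
    simp [h0] at this
  have hinv : PowerSeries.mk (starInvC d) = S := by
    have h1 := starInvC_mul_mk d hd0
    rw [← hmd] at hS1
    calc PowerSeries.mk (starInvC d) = PowerSeries.mk (starInvC d) * (PowerSeries.mk d * S) := by
          rw [hS1, mul_one]
      _ = S := by rw [← mul_assoc, h1, one_mul]
  have hh : PowerSeries.mk (hdqC a p) =
      (1 - X * C (star p)) * PowerSeries.mk (diffQuotC a p) * PowerSeries.mk (starInvC d) := by
    rw [hdqC, mk_starMulC, mk_starMulC, mk_oneMinus]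
  refine ⟨hf, hR, ?_, ?_, S, hS1⟩
  · rw [hh, hinv]
    exact ((AS_one.sub (AS_X.mul (AS_C _))).mul hR).mul hS
  · rw [hh, ← hmd, mul_assoc, starInvC_mul_mk d hd0, mul_one]

theorem blaschke_case (a : ℕ → H) (ha : SelfMap a) (p : H) (hp : ‖p‖ < 1) (hB : IsBlaschke a 1) :
    ∃ U : H, ‖U‖ = 1 ∧ PowerSeries.mk (hdqC a p) = C U := by
  obtain ⟨hf, hR, hh, hhD, S, hS⟩ := main_setup a ha p hp
  obtain ⟨t, u, ht, hu, h⟩ := (isBlaschke_one a).1 hB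
  obtain ⟨v, hv⟩ := exists_sylv' hp (show ‖star t‖ < 1 by rwa [norm_star]) 1
  have hASt : AS (X * C (star t)) := AS_X.mul (AS_C _)
  have hw : evalC a p = (p * v - v * t) * u := by
    have h1 := congrArg (fun y => ev y p v) h
    rw [ev_mul (AS_one.sub hASt) hf hp, ev_sub AS_one hASt hp, ev_one, ev_mul AS_X (AS_C _) hp,
      ev_X, ev_C, hv, ev_mul (AS_X.sub (AS_C _)) (AS_C _) hp, ev_sub AS_X (AS_C _) hp, ev_X, ev_C,
      ev_C] at h1
    rw [evalC_eq_ev, h1]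
  obtain ⟨A, hA, hU, h0, h1, h2, h3⟩ := alg_back hp hu hv hw rfl
  refine ⟨_, hU, ?_⟩
  have h4 := (mob_equiv hA h0 h1 h2 h3).2 h
  rw [← diffQuot_eq hf hp, ← mul_assoc (1 - X * C (star p)), ← swap_comm,
    mul_assoc (X - C p) _ (PowerSeries.mk (diffQuotC a p)), ← hhD] at h4
  have hX : (X - C p : PowerSeries H) ≠ 0 := by
    intro h5
    have := congrArg (coeff 1) h5
    simp [coeff_C, coeff_X] at this
  have h5 := mul_left_cancel₀ hX h4
  have h6 := congrArg (fun y => y * S) h5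
  rw [mul_assoc _ _ S, mul_assoc (PowerSeries.mk (hdqC a p)) _ S, hS, mul_one, mul_one] at h6
  exact h6.symm

/-- `|f⋆_p(q)| ≤ 1` on `𝔹`; strictly unless `f` is a regular Möbius
transformation times a unimodular constant, in which case `f⋆_p` is a
unimodular constant. -/
theorem hdq_le_one (a : ℕ → H) (ha : SelfMap a) (p : H) (hp : ‖p‖ < 1) :
    (∀ q : H, ‖q‖ < 1 → ‖evalC (hdqC a p) q‖ ≤ 1) ∧
    (¬ IsBlaschke a 1 → ∀ q : H, ‖q‖ < 1 → ‖evalC (hdqC a p) q‖ < 1) ∧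
    (IsBlaschke a 1 → ∃ u : H, ‖u‖ = 1 ∧ ∀ q : H, ‖q‖ < 1 → evalC (hdqC a p) q = u) := by
  obtain ⟨hf, hR, hh, hhD, S, hS⟩ := main_setup a ha p hp
  have hw := ha.2 p hp
  have hb : ∀ (z : ℂ), ‖z‖ < 1 → ∀ v : H, ‖ev (PowerSeries.mk (hdqC a p)) z v‖ ≤ ‖v‖ :=
    fun z hz v => limit_bound hf (contr_of_selfMap ha) hR hh hw hp (diffQuot_eq hf hp) hhD z hz v
  have hle : ∀ q : H, ‖q‖ < 1 → ‖evalC (hdqC a p) q‖ ≤ 1 := by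
    intro q hq
    obtain ⟨z, v, hv, hz⟩ := exists_conj q
    have h1 := hb z (by rwa [norm_of_conj hv hz]) v
    rw [ev_of_conj _ hv hz, norm_mul, ← evalC_eq_ev] at h1
    have hv0 : 0 < ‖v‖ := norm_pos_iff.2 hv
    exact le_of_mul_le_mul_left (by rwa [mul_one]) hv0
  refine ⟨hle, ?_, ?_⟩
  · intro hB q hq
    refine lt_of_le_of_ne (hle q hq) fun heq => hB ?_
    obtain ⟨z, v, hv, hz⟩ := exists_conj q
    have hz1 : ‖z‖ < 1 := by rwa [norm_of_conj hv hz]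
    obtain ⟨U, hU, hhU⟩ := max_strict hh v hv (fun z hz => hb z hz v) z hz1
      (by rw [ev_of_conj _ hv hz, norm_mul, ← evalC_eq_ev, heq, mul_one])
    obtain ⟨A, t, u, hA, ht, hu, h0, h1, h2, h3⟩ := alg_forward hp hw hU
    refine (isBlaschke_one a).2 ⟨t, u, ht, hu, (mob_equiv hA h0 h1 h2 h3).1 ?_⟩
    rw [← diffQuot_eq hf hp, ← mul_assoc (1 - X * C (star p)), ← swap_comm,
      mul_assoc (X - C p) _ (PowerSeries.mk (diffQuotC a p)), ← hhD, hhU]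
  · intro hB
    obtain ⟨U, hU, hhU⟩ := blaschke_case a ha p hp hB
    refine ⟨U, hU, fun q hq => ?_⟩
    rw [evalC_eq_ev, hhU, ev_C, one_mul]


end QPaper
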